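/- arXiv:1707.01190 — 5 statements merged into one kernel-verified Lean document; each statement's English description precedes it below -/
import Mathlib

section
/- Let Ω ⊂ ℝⁿ be a bounded open set and T, T₀ : Ω → ℝⁿ be C¹ maps, each injective on Ω with invertible differential at every point, with T(Ω) = T₀(Ω) = Ω*. Let f be continuous, positive and integrable on Ω, f* continuous, positive and integrable on Ω*, with ∫_Ω f = ∫_{Ω*} f*. Let h : Ω → ℝ be continuous, t ∈ [0,1], c ≥ 0, and suppose that |det DT(x)|·f*(T(x)) = e^{c h(x)} [ t f(x) + (1−t) f*(T₀(x)) |det DT₀(x)| ] for every x ∈ Ω, and that e^{ch} f and e^{ch}(f*∘T₀)|det DT₀| are integrable on Ω. Then t ∫_Ω (e^{ch} − 1) f + (1−t) ∫_Ω (e^{ch} − 1) (f*∘T₀) |det DT₀| = 0. -/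
open MeasureTheory

/-- Identity (3.6): multiplying the homotopy family of prescribed Jacobian equations by
`f* ∘ T` and integrating over `Ω`, using change of variables and conservation of energy,
gives `t ∫_Ω (e^{ch} − 1) f + (1 − t) ∫_Ω (e^{ch} − 1)(f* ∘ T₀)|det DT₀| = 0`. -/
theorem homotopy_integral_identity {n : ℕ}
    (Ω Ωs : Set (EuclideanSpace ℝ (Fin n)))
    (hΩo : IsOpen Ω) (hΩb : Bornology.IsBounded Ω)
    (T T₀ : EuclideanSpace ℝ (Fin n) → EuclideanSpace ℝ (Fin n))
    (T' T₀' : EuclideanSpace ℝ (Fin n) →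
      (EuclideanSpace ℝ (Fin n) →L[ℝ] EuclideanSpace ℝ (Fin n)))
    (hT : ∀ x ∈ Ω, HasFDerivAt T (T' x) x)
    (hT0 : ∀ x ∈ Ω, HasFDerivAt T₀ (T₀' x) x)
    (hT'cont : ContinuousOn T' Ω) (hT₀'cont : ContinuousOn T₀' Ω)
    (hTinj : Set.InjOn T Ω) (hT0inj : Set.InjOn T₀ Ω)
    (hT'inv : ∀ x ∈ Ω, (T' x).det ≠ 0) (hT₀'inv : ∀ x ∈ Ω, (T₀' x).det ≠ 0)
    (hTim : T '' Ω = Ωs) (hT0im : T₀ '' Ω = Ωs)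
    (f fs : EuclideanSpace ℝ (Fin n) → ℝ)
    (hf : Continuous f) (hfs : Continuous fs)
    (hfpos : ∀ x ∈ Ω, 0 < f x) (hfspos : ∀ y ∈ Ωs, 0 < fs y)
    (hfi : IntegrableOn f Ω) (hfsi : IntegrableOn fs Ωs)
    (hbal : ∫ x in Ω, f x = ∫ y in Ωs, fs y)
    (h : EuclideanSpace ℝ (Fin n) → ℝ) (hh : ContinuousOn h Ω)
    (t : ℝ) (ht : t ∈ Set.Icc (0 : ℝ) 1) (c : ℝ) (hc : 0 ≤ c)
    (heq : ∀ x ∈ Ω,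
      |(T' x).det| * fs (T x) =
        Real.exp (c * h x) * (t * f x + (1 - t) * (fs (T₀ x) * |(T₀' x).det|)))
    (hint1 : IntegrableOn (fun x => Real.exp (c * h x) * f x) Ω)
    (hint2 : IntegrableOn (fun x => Real.exp (c * h x) * (fs (T₀ x) * |(T₀' x).det|)) Ω) :
    t * (∫ x in Ω, (Real.exp (c * h x) - 1) * f x) +
      (1 - t) * (∫ x in Ω, (Real.exp (c * h x) - 1) * (fs (T₀ x) * |(T₀' x).det|)) = 0 := by
  have hΩm := hΩo.measurableSet
  have hT_within := fun x hx => (hT x hx).hasFDerivWithinAt (s := Ω)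
  have hT0_within := fun x hx => (hT0 x hx).hasFDerivWithinAt (s := Ω)
  have hcv : ∫ y in Ωs, fs y = ∫ x in Ω, |(T' x).det| * fs (T x) := by
    rw [← hTim]
    exact integral_image_eq_integral_abs_det_fderiv_smul volume hΩm hT_within hTinj fs
  have hcv0 : ∫ y in Ωs, fs y = ∫ x in Ω, fs (T₀ x) * |(T₀' x).det| := by
    rw [← hT0im, integral_image_eq_integral_abs_det_fderiv_smul volume hΩm hT0_within hT0inj fs]
    simp only [smul_eq_mul, mul_comm]
  have hint0 : IntegrableOn (fun x => fs (T₀ x) * |(T₀' x).det|) Ω := by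
    rw [← hT0im] at hfsi
    simpa only [smul_eq_mul, mul_comm] using
      (integrableOn_image_iff_integrableOn_abs_det_fderiv_smul volume hΩm hT0_within hT0inj
        fs).1 hfsi
  have hsplit : ∫ x in Ω, |(T' x).det| * fs (T x) =
      t * (∫ x in Ω, Real.exp (c * h x) * f x) +
        (1 - t) * ∫ x in Ω, Real.exp (c * h x) * (fs (T₀ x) * |(T₀' x).det|) := by
    rw [← integral_const_mul, ← integral_const_mul,
      ← integral_add (hint1.const_mul t) (hint2.const_mul (1 - t))]
    refine setIntegral_congr_fun hΩm fun x hx => ?_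
    simp only [heq x hx]
    ring
  simp only [sub_mul, one_mul] at hsplit ⊢
  rw [integral_sub hint1 hfi, integral_sub hint2 hint0]
  linear_combination (1 - t) * hcv0 - t * hbal - hsplit - hcv
end

section
/- Let U ⊂ ℝⁿ×ℝⁿ×ℝ be open and g ∈ C²(U) with ∂_z g ≠ 0 on U. Define the n×n matrix field E on U by E_{ij} = ∂²g/∂x_i∂y_j − (∂_z g)^{−1} (∂²g/∂x_i∂z)(∂g/∂y_j), i.e. E = g_{xy} − (g_z)^{−1} g_{xz} ⊗ g_y. Let Ω ⊂ ℝⁿ be open, u : Ω → ℝ twice differentiable, and Y : Ω → ℝⁿ, Z : Ω → ℝ differentiable maps with (x, Y(x), Z(x)) ∈ U, g(x, Y(x), Z(x)) = u(x) and ∇_x g(x, Y(x), Z(x)) = ∇u(x) for every x ∈ Ω. Then for every x ∈ Ω, D²u(x) − g_{xx}(x, Y(x), Z(x)) = E(x, Y(x), Z(x)) · DY(x) as n×n matrices, and consequently det[D²u(x) − g_{xx}(x, Y(x), Z(x))] = det E(x, Y(x), Z(x)) · det DY(x). -/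
/-- Partial derivative of `g(x,y,z)` in the coordinate `x i`. -/
noncomputable def pdX {n : ℕ} (g : (Fin n → ℝ) → (Fin n → ℝ) → ℝ → ℝ)
    (i : Fin n) (x y : Fin n → ℝ) (z : ℝ) : ℝ :=
  deriv (fun s => g (Function.update x i s) y z) (x i)

/-- Partial derivative of `g(x,y,z)` in the coordinate `y j`. -/
noncomputable def pdY {n : ℕ} (g : (Fin n → ℝ) → (Fin n → ℝ) → ℝ → ℝ)
    (j : Fin n) (x y : Fin n → ℝ) (z : ℝ) : ℝ :=
  deriv (fun s => g x (Function.update y j s) z) (y j)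

/-- Partial derivative of `g(x,y,z)` in `z`. -/
noncomputable def pdZ {n : ℕ} (g : (Fin n → ℝ) → (Fin n → ℝ) → ℝ → ℝ)
    (x y : Fin n → ℝ) (z : ℝ) : ℝ :=
  deriv (fun s => g x y s) z

/-- Partial derivative in the coordinate `x i` of a function of `x` alone. -/
noncomputable def pdU {n : ℕ} (u : (Fin n → ℝ) → ℝ) (i : Fin n) (x : Fin n → ℝ) : ℝ :=
  deriv (fun s => u (Function.update x i s)) (x i)

/-- The matrix `E = g_{xy} − (g_z)⁻¹ g_{xz} ⊗ g_y` associated with a generating function. -/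
noncomputable def Emat {n : ℕ} (g : (Fin n → ℝ) → (Fin n → ℝ) → ℝ → ℝ)
    (x y : Fin n → ℝ) (z : ℝ) : Matrix (Fin n) (Fin n) ℝ :=
  Matrix.of fun i j =>
    pdX (fun x' y' z' => pdY g j x' y' z') i x y z -
      (pdZ g x y z)⁻¹ * pdX (fun x' y' z' => pdZ g x' y' z') i x y z * pdY g j x y z

/-- The map `(x, y, z) ↦ g x y z` on the product space. -/
def uncurryGen {n : ℕ} (g : (Fin n → ℝ) → (Fin n → ℝ) → ℝ → ℝ)
    (w : (Fin n → ℝ) × (Fin n → ℝ) × ℝ) : ℝ :=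
  g w.1 w.2.1 w.2.2

theorem pdU_eq_of_hasFDerivAt {n : ℕ} {u : (Fin n → ℝ) → ℝ} {x : Fin n → ℝ}
    {L : (Fin n → ℝ) →L[ℝ] ℝ} (h : HasFDerivAt u L x) (i : Fin n) :
    pdU u i x = L (Pi.single i 1) := by
  have h' : HasFDerivAt u L (Function.update x i (x i)) := by simpa using h
  exact (h'.comp_hasDerivAt (x i) (hasDerivAt_update x i (x i))).deriv

theorem pdX_eq_of_hasFDerivAt {n : ℕ} {g : (Fin n → ℝ) → (Fin n → ℝ) → ℝ → ℝ}
    {x y : Fin n → ℝ} {z : ℝ} {L : (Fin n → ℝ) × (Fin n → ℝ) × ℝ →L[ℝ] ℝ}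
    (h : HasFDerivAt (uncurryGen g) L (x, y, z)) (i : Fin n) :
    pdX g i x y z = L (Pi.single i 1, 0, 0) := by
  have h' : HasFDerivAt (uncurryGen g) L (Function.update x i (x i), y, z) := by simpa using h
  exact (h'.comp_hasDerivAt (x i) ((hasDerivAt_update x i (x i)).prodMk
    ((hasDerivAt_const (x i) y).prodMk (hasDerivAt_const (x i) z)))).deriv

theorem pdY_eq_of_hasFDerivAt {n : ℕ} {g : (Fin n → ℝ) → (Fin n → ℝ) → ℝ → ℝ}
    {x y : Fin n → ℝ} {z : ℝ} {L : (Fin n → ℝ) × (Fin n → ℝ) × ℝ →L[ℝ] ℝ}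
    (h : HasFDerivAt (uncurryGen g) L (x, y, z)) (j : Fin n) :
    pdY g j x y z = L (0, Pi.single j 1, 0) := by
  have h' : HasFDerivAt (uncurryGen g) L (x, Function.update y j (y j), z) := by simpa using h
  exact (h'.comp_hasDerivAt (y j) ((hasDerivAt_const (y j) x).prodMk
    ((hasDerivAt_update y j (y j)).prodMk (hasDerivAt_const (y j) z)))).deriv

theorem pdZ_eq_of_hasFDerivAt {n : ℕ} {g : (Fin n → ℝ) → (Fin n → ℝ) → ℝ → ℝ}
    {x y : Fin n → ℝ} {z : ℝ} {L : (Fin n → ℝ) × (Fin n → ℝ) × ℝ →L[ℝ] ℝ}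
    (h : HasFDerivAt (uncurryGen g) L (x, y, z)) :
    pdZ g x y z = L (0, 0, 1) :=
  (HasFDerivAt.comp_hasDerivAt (f := fun s => (x, y, s)) z h ((hasDerivAt_const z x).prodMk
    ((hasDerivAt_const z y).prodMk (hasDerivAt_id z)))).deriv

theorem ContinuousLinearMap.apply_prod_pi_prod {n : ℕ}
    (L : (Fin n → ℝ) × (Fin n → ℝ) × ℝ →L[ℝ] ℝ) (a b : Fin n → ℝ) (c : ℝ) :
    L (a, b, c) = L (a, 0, 0) + ∑ k, L (0, Pi.single k 1, 0) * b k + L (0, 0, 1) * c := by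
  have hb : ∑ k, L (0, Pi.single k 1, 0) * b k = L (0, b, 0) := by
    have h := LinearMap.pi_apply_eq_sum_univ
      (L.toLinearMap ∘ₗ LinearMap.inr ℝ (Fin n → ℝ) ((Fin n → ℝ) × ℝ) ∘ₗ
        LinearMap.inl ℝ (Fin n → ℝ) ℝ) b
    simp only [LinearMap.comp_apply, LinearMap.inr_apply, LinearMap.inl_apply,
      ContinuousLinearMap.coe_coe, smul_eq_mul] at h
    rw [h]
    refine Finset.sum_congr rfl fun k _ => ?_
    rw [mul_comm]
    congr 4
    ext j
    simp [Pi.single_apply, eq_comm]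
  have hc : L (0, 0, 1) * c = L (0, 0, c) := by
    rw [mul_comm, ← smul_eq_mul, ← map_smul]
    simp
  rw [hb, hc, ← map_add, ← map_add]
  simp

theorem hasFDerivAt_fderiv_apply {E : Type*} [NormedAddCommGroup E] [NormedSpace ℝ E]
    {f F : E → ℝ} {w : E} (hf : DifferentiableAt ℝ (fderiv ℝ f) w) (v : E)
    (hF : ∀ᶠ w' in nhds w, F w' = fderiv ℝ f w' v) :
    HasFDerivAt F ((fderiv ℝ (fderiv ℝ f) w).flip v) w := by
  refine HasFDerivAt.congr_of_eventuallyEq ?_ hF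
  exact (ContinuousLinearMap.apply ℝ ℝ v).hasFDerivAt.comp w hf.hasFDerivAt

/-- Derivation of the generated prescribed Jacobian equation (1.5):
from `g(x,Y,Z) = u`, `g_x(x,Y,Z) = Du`, one has
`D²u − g_xx(·,Y,Z) = E(·,Y,Z) · DY` and hence
`det[D²u − g_xx(·,Y,Z)] = det E(·,Y,Z) · det DY`. -/
theorem generated_prescribed_jacobian_equation {n : ℕ}
    (U : Set ((Fin n → ℝ) × (Fin n → ℝ) × ℝ)) (hU : IsOpen U)
    (g : (Fin n → ℝ) → (Fin n → ℝ) → ℝ → ℝ)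
    (hg : ContDiffOn ℝ 2 (fun w : (Fin n → ℝ) × (Fin n → ℝ) × ℝ => g w.1 w.2.1 w.2.2) U)
    (hgz : ∀ w ∈ U, pdZ g w.1 w.2.1 w.2.2 ≠ 0)
    (Ω : Set (Fin n → ℝ)) (hΩ : IsOpen Ω)
    (u : (Fin n → ℝ) → ℝ)
    (hu1 : ∀ x ∈ Ω, DifferentiableAt ℝ u x)
    (hu2 : ∀ x ∈ Ω, DifferentiableAt ℝ (fderiv ℝ u) x)
    (Y : (Fin n → ℝ) → (Fin n → ℝ)) (Z : (Fin n → ℝ) → ℝ)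
    (hY : ∀ x ∈ Ω, DifferentiableAt ℝ Y x)
    (hZ : ∀ x ∈ Ω, DifferentiableAt ℝ Z x)
    (hmem : ∀ x ∈ Ω, (x, Y x, Z x) ∈ U)
    (hval : ∀ x ∈ Ω, g x (Y x) (Z x) = u x)
    (hgrad : ∀ x ∈ Ω, ∀ i, pdX g i x (Y x) (Z x) = pdU u i x) :
    ∀ x ∈ Ω,
      (Matrix.of fun i j =>
          pdU (fun x' => pdU u j x') i x -
            pdX (fun x' y' z' => pdX g j x' y' z') i x (Y x) (Z x))
        = Emat g x (Y x) (Z x) * (Matrix.of fun k j => pdU (fun x' => Y x' k) j x)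
      ∧
      (Matrix.of fun i j =>
          pdU (fun x' => pdU u j x') i x -
            pdX (fun x' y' z' => pdX g j x' y' z') i x (Y x) (Z x)).det
        = (Emat g x (Y x) (Z x)).det *
            (Matrix.of fun k j => pdU (fun x' => Y x' k) j x).det := by
  intro x hx
  set G := uncurryGen g
  have hG : ∀ w ∈ U, ContDiffAt ℝ 2 G w := fun w hw => hg.contDiffAt (hU.mem_nhds hw)
  have hG1 : ∀ w ∈ U, HasFDerivAt G (fderiv ℝ G w) w := fun w hw =>
    ((hG w hw).differentiableAt (by norm_num)).hasFDerivAt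
  have hw := hmem x hx
  have hG2 : DifferentiableAt ℝ (fderiv ℝ G) (x, Y x, Z x) :=
    ((hG _ hw).fderiv_right (m := 1) (by norm_num)).differentiableAt (by norm_num)
  have hUn := hU.mem_nhds hw
  have hΩn := hΩ.mem_nhds hx
  have hGsymm : ∀ v v', fderiv ℝ (fderiv ℝ G) (x, Y x, Z x) v v' =
      fderiv ℝ (fderiv ℝ G) (x, Y x, Z x) v' v := fun v v' =>
    second_derivative_symmetric_of_eventually
      (Filter.eventually_of_mem hUn hG1) hG2.hasFDerivAt v v'
  have husymm : ∀ v v', fderiv ℝ (fderiv ℝ u) x v v' = fderiv ℝ (fderiv ℝ u) x v' v := fun v v' =>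
    second_derivative_symmetric_of_eventually
      (Filter.eventually_of_mem hΩn fun x' hx' => (hu1 x' hx').hasFDerivAt)
      (hu2 x hx).hasFDerivAt v v'
  set F := fderiv ℝ G (x, Y x, Z x) with hF
  set S := fderiv ℝ (fderiv ℝ G) (x, Y x, Z x) with hS
  have hγ : HasFDerivAt (fun x' => (x', Y x', Z x'))
      ((ContinuousLinearMap.id ℝ _).prod ((fderiv ℝ Y x).prod (fderiv ℝ Z x))) x :=
    (hasFDerivAt_id x).prodMk ((hY x hx).hasFDerivAt.prodMk (hZ x hx).hasFDerivAt)
  have hYk : ∀ k j, pdU (fun x' => Y x' k) j x = fderiv ℝ Y x (Pi.single j 1) k := fun k j =>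
    pdU_eq_of_hasFDerivAt (hasFDerivAt_pi'.1 (hY x hx).hasFDerivAt k) j
  have hgx : ∀ x' ∈ Ω, ∀ i, fderiv ℝ u x' (Pi.single i 1) =
      fderiv ℝ G (x', Y x', Z x') (Pi.single i 1, 0, 0) := fun x' hx' i => by
    rw [← pdU_eq_of_hasFDerivAt (hu1 x' hx').hasFDerivAt i, ← hgrad x' hx' i,
      pdX_eq_of_hasFDerivAt (hG1 _ (hmem x' hx')) i]
  -- the derivative of `g(x, Y, Z) = u`
  have first : ∀ v, fderiv ℝ u x v = F (v, fderiv ℝ Y x v, fderiv ℝ Z x v) := fun v => by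
    have h0 := HasFDerivAt.comp (g := G) x (hG1 _ hw) hγ
    have h1 := h0.congr_of_eventuallyEq (f₁ := u)
      (Filter.eventually_of_mem hΩn fun x' hx' => (hval x' hx').symm)
    rw [h1.fderiv]
    rfl
  -- the derivative of `g_x(x, Y, Z) = Du`
  have second : ∀ v i, fderiv ℝ (fderiv ℝ u) x v (Pi.single i 1) =
      S (v, fderiv ℝ Y x v, fderiv ℝ Z x v) (Pi.single i 1, 0, 0) := fun v i => by
    have h1 := hasFDerivAt_fderiv_apply (hu2 x hx) (Pi.single i 1)
      (Filter.Eventually.of_forall fun _ => rfl)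
    have h2 := (hasFDerivAt_fderiv_apply hG2 (Pi.single i 1, 0, 0)
      (Filter.Eventually.of_forall fun _ => rfl)).comp x hγ
    have h3 := h1.unique (h2.congr_of_eventuallyEq
      (Filter.eventually_of_mem hΩn fun x' hx' => hgx x' hx' i))
    exact DFunLike.congr_fun h3 v
  have hpdZ : pdZ g x (Y x) (Z x) = F (0, 0, 1) := pdZ_eq_of_hasFDerivAt (hG1 _ hw)
  have hpdY : ∀ k, pdY g k x (Y x) (Z x) = F (0, Pi.single k 1, 0) :=
    pdY_eq_of_hasFDerivAt (hG1 _ hw)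
  have hne : F (0, 0, 1) ≠ 0 := hpdZ ▸ hgz _ hw
  have hxx : ∀ i j, pdX (fun x' y' z' => pdX g j x' y' z') i x (Y x) (Z x) =
      S (Pi.single i 1, 0, 0) (Pi.single j 1, 0, 0) := fun i j =>
    pdX_eq_of_hasFDerivAt (g := pdX g j) (hasFDerivAt_fderiv_apply hG2 (Pi.single j 1, 0, 0)
      (Filter.eventually_of_mem hUn fun w' hw' => pdX_eq_of_hasFDerivAt (hG1 w' hw') j)) i
  have hxy : ∀ i k, pdX (fun x' y' z' => pdY g k x' y' z') i x (Y x) (Z x) =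
      S (Pi.single i 1, 0, 0) (0, Pi.single k 1, 0) := fun i k =>
    pdX_eq_of_hasFDerivAt (g := pdY g k) (hasFDerivAt_fderiv_apply hG2 (0, Pi.single k 1, 0)
      (Filter.eventually_of_mem hUn fun w' hw' => pdY_eq_of_hasFDerivAt (hG1 w' hw') k)) i
  have hxz : ∀ i, pdX (fun x' y' z' => pdZ g x' y' z') i x (Y x) (Z x) =
      S (Pi.single i 1, 0, 0) (0, 0, 1) := fun i =>
    pdX_eq_of_hasFDerivAt (g := pdZ g) (hasFDerivAt_fderiv_apply hG2 (0, 0, 1)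
      (Filter.eventually_of_mem hUn fun w' hw' => pdZ_eq_of_hasFDerivAt (hG1 w' hw'))) i
  have huu : ∀ i j, pdU (fun x' => pdU u j x') i x =
      fderiv ℝ (fderiv ℝ u) x (Pi.single i 1) (Pi.single j 1) := fun i j =>
    pdU_eq_of_hasFDerivAt (hasFDerivAt_fderiv_apply (hu2 x hx) _
      (Filter.eventually_of_mem hΩn fun x' hx' =>
        pdU_eq_of_hasFDerivAt (hu1 x' hx').hasFDerivAt j)) i
  have hmat : (Matrix.of fun i j =>
      pdU (fun x' => pdU u j x') i x -
        pdX (fun x' y' z' => pdX g j x' y' z') i x (Y x) (Z x))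
      = Emat g x (Y x) (Z x) * (Matrix.of fun k j => pdU (fun x' => Y x' k) j x) := by
    ext i j
    have h1 := first (Pi.single j 1)
    rw [hgx x hx j, F.apply_prod_pi_prod _ (fderiv ℝ Y x _)] at h1
    have hDZ : fderiv ℝ Z x (Pi.single j 1) = -((F (0, 0, 1))⁻¹ *
        ∑ k, F (0, Pi.single k 1, 0) * fderiv ℝ Y x (Pi.single j 1) k) := by
      field_simp
      linarith
    simp only [Matrix.of_apply, Matrix.mul_apply, Emat, huu, hxx, hxy, hxz, hpdY, hpdZ, hYk]
    rw [husymm, second, hGsymm, (S _).apply_prod_pi_prod _ (fderiv ℝ Y x _), hDZ]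
    simp only [sub_mul, Finset.sum_sub_distrib, Finset.mul_sum, mul_neg]
    rw [add_sub_right_comm, add_sub_cancel_left, ← sub_eq_add_neg]
    congr 1
    exact Finset.sum_congr rfl fun k _ => by ring
  exact ⟨hmat, by rw [hmat, Matrix.det_mul]⟩
end

section
/- Let U ⊂ ℝⁿ×ℝⁿ×ℝ be open and g ∈ C²(U) with ∂_z g ≠ 0 on U, and let E = g_{xy} − (g_z)^{−1} g_{xz} ⊗ g_y. Define Q = −g_y/g_z : U → ℝⁿ. Then at each (x,y,z) ∈ U, the Jacobian matrix of the map x ↦ Q(x,y,z) equals −(g_z)^{−1} Eᵗ(x,y,z), where Eᵗ denotes the transpose of E; in particular det D_xQ(x,y,z) = (−1/g_z(x,y,z))ⁿ det E(x,y,z), which is nonzero whenever det E(x,y,z) ≠ 0. -/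
section PartialDerivatives

variable {n : ℕ} {U : Set ((Fin n → ℝ) × (Fin n → ℝ) × ℝ)}
  {g : (Fin n → ℝ) → (Fin n → ℝ) → ℝ → ℝ}

theorem pdY_eq_fderiv {x y : Fin n → ℝ} {z : ℝ}
    (h : DifferentiableAt ℝ (fun w : (Fin n → ℝ) × (Fin n → ℝ) × ℝ => g w.1 w.2.1 w.2.2) (x, y, z))
    (j : Fin n) :
    pdY g j x y z =
      fderiv ℝ (fun w : (Fin n → ℝ) × (Fin n → ℝ) × ℝ => g w.1 w.2.1 w.2.2) (x, y, z)
        (0, Pi.single j 1, 0) := by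
  have hc : HasDerivAt (fun s : ℝ => (x, Function.update y j s, z))
      ((0 : Fin n → ℝ), (Pi.single j 1 : Fin n → ℝ), (0 : ℝ)) (y j) :=
    (hasDerivAt_const _ _).prodMk ((hasDerivAt_update y j (y j)).prodMk (hasDerivAt_const _ _))
  exact (h.hasFDerivAt.comp_hasDerivAt_of_eq (y j) hc (by simp)).deriv

theorem pdZ_eq_fderiv {x y : Fin n → ℝ} {z : ℝ}
    (h : DifferentiableAt ℝ
      (fun w : (Fin n → ℝ) × (Fin n → ℝ) × ℝ => g w.1 w.2.1 w.2.2) (x, y, z)) :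
    pdZ g x y z =
      fderiv ℝ (fun w : (Fin n → ℝ) × (Fin n → ℝ) × ℝ => g w.1 w.2.1 w.2.2) (x, y, z)
        (0, 0, 1) := by
  have hc : HasDerivAt (fun s : ℝ => (x, y, s))
      ((0 : Fin n → ℝ), (0 : Fin n → ℝ), (1 : ℝ)) z :=
    (hasDerivAt_const _ _).prodMk ((hasDerivAt_const _ _).prodMk (hasDerivAt_id _))
  exact (h.hasFDerivAt.comp_hasDerivAt_of_eq z hc rfl).deriv

/-- A function that agrees on `U` with a directional derivative of a `C²` function is
differentiable along the coordinate lines in `x`. -/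
theorem differentiableAt_update_of_eqOn_fderiv
    {G : (Fin n → ℝ) × (Fin n → ℝ) × ℝ → ℝ} (hU : IsOpen U) (hG : ContDiffOn ℝ 2 G U)
    {f : (Fin n → ℝ) → (Fin n → ℝ) → ℝ → ℝ} (v : (Fin n → ℝ) × (Fin n → ℝ) × ℝ)
    (hf : ∀ w ∈ U, f w.1 w.2.1 w.2.2 = fderiv ℝ G w v)
    {x y : Fin n → ℝ} {z : ℝ} (hw : (x, y, z) ∈ U) (i : Fin n) :
    DifferentiableAt ℝ (fun s => f (Function.update x i s) y z) (x i) := by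
  have hc : DifferentiableAt ℝ (fun s : ℝ => (Function.update x i s, y, z)) (x i) :=
    (hasDerivAt_update x i (x i)).differentiableAt.prodMk (differentiableAt_const _)
  have hx : (Function.update x i (x i), y, z) = (x, y, z) := by simp
  have hd : DifferentiableAt ℝ (fun w => fderiv ℝ G w v) (Function.update x i (x i), y, z) := by
    rw [hx]
    exact (((hG.fderiv_of_isOpen hU (m := 1) (by norm_num)).differentiableOn
      one_ne_zero).differentiableAt (hU.mem_nhds hw)).clm_apply (differentiableAt_const v)
  refine (hd.comp (x i) hc).congr_of_eventuallyEq ?_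
  have hmem := hc.continuousAt.preimage_mem_nhds (hU.mem_nhds (hx ▸ hw))
  filter_upwards [hmem] with s hs using hf _ hs

end PartialDerivatives

open Matrix in
/-- The Jacobian in `x` of the map `Q = −g_y/g_z` equals `−(g_z)⁻¹ Eᵗ`; in particular
`det D_xQ = (−1/g_z)ⁿ det E`, which is nonzero whenever `det E ≠ 0`, so condition A2 is
self-dual. -/
theorem jacobian_of_Q_eq {n : ℕ}
    (U : Set ((Fin n → ℝ) × (Fin n → ℝ) × ℝ)) (hU : IsOpen U)
    (g : (Fin n → ℝ) → (Fin n → ℝ) → ℝ → ℝ)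
    (hg : ContDiffOn ℝ 2 (fun w : (Fin n → ℝ) × (Fin n → ℝ) × ℝ => g w.1 w.2.1 w.2.2) U)
    (hgz : ∀ w ∈ U, pdZ g w.1 w.2.1 w.2.2 ≠ 0) :
    ∀ x y : Fin n → ℝ, ∀ z : ℝ, (x, y, z) ∈ U →
      (Matrix.of fun j i =>
          pdX (fun x' y' z' => -(pdY g j x' y' z') / pdZ g x' y' z') i x y z)
        = (-(pdZ g x y z)⁻¹) • (Emat g x y z)ᵀ
      ∧
      (Matrix.of fun j i =>
          pdX (fun x' y' z' => -(pdY g j x' y' z') / pdZ g x' y' z') i x y z).det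
        = (-(1 : ℝ) / pdZ g x y z) ^ n * (Emat g x y z).det
      ∧
      ((Emat g x y z).det ≠ 0 →
        (Matrix.of fun j i =>
          pdX (fun x' y' z' => -(pdY g j x' y' z') / pdZ g x' y' z') i x y z).det ≠ 0) := by
  intro x y z hw
  have hd : ∀ w ∈ U, DifferentiableAt ℝ
      (fun w : (Fin n → ℝ) × (Fin n → ℝ) × ℝ => g w.1 w.2.1 w.2.2) w := fun w hw =>
    (hg.differentiableOn two_ne_zero).differentiableAt (hU.mem_nhds hw)
  have hz : pdZ g x y z ≠ 0 := hgz _ hw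
  have hJ : (Matrix.of fun j i =>
      pdX (fun x' y' z' => -(pdY g j x' y' z') / pdZ g x' y' z') i x y z)
        = (-(pdZ g x y z)⁻¹) • (Emat g x y z)ᵀ := by
    ext j i
    have hY := differentiableAt_update_of_eqOn_fderiv hU hg (f := pdY g j)
      _ (fun w hw => pdY_eq_fderiv (hd w hw) j) hw i
    have hZ := differentiableAt_update_of_eqOn_fderiv hU hg (f := pdZ g)
      _ (fun w hw => pdZ_eq_fderiv (hd w hw)) hw i
    have hQ := (hY.hasDerivAt.fun_neg.fun_div hZ.hasDerivAt (by simpa using hz)).deriv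
    simp only [Function.update_eq_self] at hQ
    simp only [Matrix.of_apply, Matrix.smul_apply, Matrix.transpose_apply, Emat, pdX, smul_eq_mul]
    rw [hQ]
    field_simp
    ring
  have hdet : (Matrix.of fun j i =>
      pdX (fun x' y' z' => -(pdY g j x' y' z') / pdZ g x' y' z') i x y z).det
        = (-(1 : ℝ) / pdZ g x y z) ^ n * (Emat g x y z).det := by
    rw [hJ, Matrix.det_smul, Matrix.det_transpose, Fintype.card_fin, neg_div, one_div]
  refine ⟨hJ, hdet, fun hE => ?_⟩
  rw [hdet]
  exact mul_ne_zero (pow_ne_zero _ (div_ne_zero (neg_ne_zero.mpr one_ne_zero) hz)) hE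
end

section
/- Let Φ ∈ ℝ be a constant, g(x,y,z) = Φ − z/2 + |x−y|²/(2z) for z < 0, and E = g_{xy} − (g_z)^{−1} g_{xz} ⊗ g_y. Then for all x, y ∈ ℝⁿ and z < 0: E(x,y,z) = −(1/z)[ Iₙ − (2/(z²+|x−y|²)) (x−y)⊗(x−y) ], and det E(x,y,z) = (−1/z)ⁿ (z² − |x−y|²)/(z² + |x−y|²). In particular det E(x,y,z) ≠ 0 if and only if g(x,y,z) ≠ Φ. -/
/-- The flat-target reflection generating function
`g(x,y,z) = Φ − z/2 + |x−y|²/(2z)`. -/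
noncomputable def gRefl {n : ℕ} (Φ : ℝ) (x y : Fin n → ℝ) (z : ℝ) : ℝ :=
  Φ - z / 2 + (∑ i, (x i - y i) ^ 2) / (2 * z)

/-- Changing one coordinate of `x` changes `|x - y|²` at rate `2 (xᵢ - yᵢ)`. -/
lemma hasDerivAt_sum_sq_update {n : ℕ} (x y : Fin n → ℝ) (i : Fin n) :
    HasDerivAt (fun s => ∑ k, (Function.update x i s k - y k) ^ 2) (2 * (x i - y i)) (x i) := by
  have h := hasDerivAt_pi.1 (hasDerivAt_update x i (x i))
  refine (HasDerivAt.fun_sum fun k _ => ((h k).sub_const (y k)).fun_pow 2).congr_deriv ?_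
  rw [Finset.sum_eq_single i] <;> simp +contextual

lemma pdY_gRefl {n : ℕ} (Φ : ℝ) (j : Fin n) (x y : Fin n → ℝ) (z : ℝ) :
    pdY (gRefl Φ) j x y z = -((x j - y j) / z) := by
  have h := ((hasDerivAt_sum_sq_update y x j).div_const (2 * z)).const_add (Φ - z / 2)
  have e : (fun s => gRefl Φ x (Function.update y j s) z) = fun s =>
      Φ - z / 2 + (∑ k, (Function.update y j s k - x k) ^ 2) / (2 * z) := by
    funext s
    simp only [gRefl, sub_sq_comm (x _)]
  rw [pdY, e, h.deriv, mul_div_mul_left _ _ two_ne_zero]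
  ring

lemma pdZ_gRefl {n : ℕ} (Φ : ℝ) (x y : Fin n → ℝ) {z : ℝ} (hz : z ≠ 0) :
    pdZ (gRefl Φ) x y z = -(z ^ 2 + ∑ i, (x i - y i) ^ 2) / (2 * z ^ 2) := by
  have h := (((hasDerivAt_id z).div_const 2).const_sub Φ).add
    ((hasDerivAt_const z (∑ i, (x i - y i) ^ 2)).div ((hasDerivAt_id z).const_mul 2)
      (mul_ne_zero two_ne_zero hz))
  refine h.deriv.trans ?_
  simp only [id]
  field_simp
  ring

lemma pdX_pdY_gRefl {n : ℕ} (Φ : ℝ) (i j : Fin n) (x y : Fin n → ℝ) (z : ℝ) :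
    pdX (pdY (gRefl Φ) j) i x y z = -(1 / z) * (1 : Matrix (Fin n) (Fin n) ℝ) i j := by
  have h := hasDerivAt_pi.1 (hasDerivAt_update x i (x i)) j
  simp only [pdX, pdY_gRefl]
  rw [((h.sub_const (y j)).div_const z).fun_neg.deriv, Matrix.one_apply, Pi.single_apply]
  simp only [eq_comm (a := j)]
  ring

lemma pdX_pdZ_gRefl {n : ℕ} (Φ : ℝ) (i : Fin n) (x y : Fin n → ℝ) {z : ℝ} (hz : z ≠ 0) :
    pdX (pdZ (gRefl Φ)) i x y z = -((x i - y i) / z ^ 2) := by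
  simp only [pdX, pdZ_gRefl Φ _ _ hz]
  rw [(((hasDerivAt_sum_sq_update x y i).const_add (z ^ 2)).fun_neg.div_const (2 * z ^ 2)).deriv]
  field_simp

lemma Emat_gRefl {n : ℕ} (Φ : ℝ) (x y : Fin n → ℝ) {z : ℝ} (hz : z ≠ 0) :
    Emat (gRefl Φ) x y z
      = (-(1 / z)) • ((1 : Matrix (Fin n) (Fin n) ℝ)
          - (2 / (z ^ 2 + ∑ i, (x i - y i) ^ 2)) •
              Matrix.vecMulVec (fun i => x i - y i) (fun j => x j - y j)) := by
  have hD : z ^ 2 + ∑ i, (x i - y i) ^ 2 ≠ 0 := by positivity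
  ext i j
  simp only [Emat, Matrix.of_apply, Matrix.smul_apply, Matrix.sub_apply, Matrix.vecMulVec_apply,
    smul_eq_mul]
  rw [pdX_pdY_gRefl, pdX_pdZ_gRefl Φ i x y hz, pdZ_gRefl Φ x y hz, pdY_gRefl]
  field_simp
  ring

/-- Rank-one case of the Weinstein-Aronszajn identity. -/
lemma det_one_sub_smul_vecMulVec {ι R : Type*} [Fintype ι] [DecidableEq ι] [CommRing R]
    (c : R) (u v : ι → R) :
    (1 - c • Matrix.vecMulVec u v).det = 1 - c * (v ⬝ᵥ u) := by
  rw [sub_eq_add_neg, ← neg_smul, ← Matrix.smul_vecMulVec, Matrix.vecMulVec_eq Unit,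
    Matrix.det_one_add_replicateCol_mul_replicateRow, dotProduct_smul, smul_eq_mul]
  ring


/-- For the flat-target reflection generating function, the matrix
`E = g_{xy} − (g_z)⁻¹ g_{xz} ⊗ g_y` equals
`−(1/z)[Iₙ − (2/(z²+|x−y|²))(x−y)⊗(x−y)]`, with
`det E = (−1/z)ⁿ (z²−|x−y|²)/(z²+|x−y|²)`; in particular `det E ≠ 0 ↔ g ≠ Φ`. -/
theorem reflection_flat_Emat {n : ℕ} (Φ : ℝ)
    (x y : Fin n → ℝ) (z : ℝ) (hz : z < 0) :
    Emat (gRefl Φ) x y z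
      = (-(1 / z)) • ((1 : Matrix (Fin n) (Fin n) ℝ)
          - (2 / (z ^ 2 + ∑ i, (x i - y i) ^ 2)) •
              Matrix.vecMulVec (fun i => x i - y i) (fun j => x j - y j))
    ∧ (Emat (gRefl Φ) x y z).det
      = (-(1 / z)) ^ n *
          ((z ^ 2 - ∑ i, (x i - y i) ^ 2) / (z ^ 2 + ∑ i, (x i - y i) ^ 2))
    ∧ ((Emat (gRefl Φ) x y z).det ≠ 0 ↔ gRefl Φ x y z ≠ Φ) := by
  have hz0 : z ≠ 0 := hz.ne
  have hD : z ^ 2 + ∑ i, (x i - y i) ^ 2 ≠ 0 := by positivity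
  have hdet : (Emat (gRefl Φ) x y z).det
      = (-(1 / z)) ^ n *
          ((z ^ 2 - ∑ i, (x i - y i) ^ 2) / (z ^ 2 + ∑ i, (x i - y i) ^ 2)) := by
    rw [Emat_gRefl Φ x y hz0, Matrix.det_smul, Fintype.card_fin, det_one_sub_smul_vecMulVec]
    simp only [dotProduct, ← pow_two]
    congr 1
    field_simp
    ring
  refine ⟨Emat_gRefl Φ x y hz0, hdet, not_congr ?_⟩
  have hg : gRefl Φ x y z - Φ = -((z ^ 2 - ∑ i, (x i - y i) ^ 2) / (2 * z)) := by
    rw [gRefl]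
    field_simp
    ring
  rw [hdet, ← sub_eq_zero (b := Φ), hg]
  simp [hz0, hD]
end

section
/- Let κ > 0 with κ ≠ 1 and κ′ = √|κ²−1|, let Φ ∈ ℝ be a constant, and let g(x,y,z) = Φ − (κz + √(z² + (κ²−1)|x−y|²))/|κ²−1| on the domain z > κ′|x−y| when 0 < κ < 1 and z > 0 when κ > 1. Fix x ∈ ℝⁿ, u < Φ, and p ∈ ℝⁿ with (κ²−1)|p|² < 1 (which is automatic when κ < 1). Set w = √(1 + (1−κ²)|p|²), Z = |κ²−1|(Φ−u)w/(1 + κw), and Y = x + sign(κ²−1)(Z/w)p. Then (x, Y, Z) belongs to the domain of g (i.e. Z > κ′|x−Y| if κ < 1 and Z > 0 if κ > 1), g(x, Y, Z) = u and ∇_x g(x, Y, Z) = p; moreover (Y, Z) is the unique pair in the domain with these properties. -/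
/-- The gradient of `x' ↦ Φ − (a + √(b + c|x'−y|²))/d` where the radicand is positive. -/
theorem hasGradientAt_sub_sqrt_div {E : Type*} [NormedAddCommGroup E] [InnerProductSpace ℝ E]
    [CompleteSpace E] (Φ a b c d : ℝ) (x y : E) (hR : 0 < b + c * ‖x - y‖ ^ 2) :
    HasGradientAt (fun x' => Φ - (a + Real.sqrt (b + c * ‖x' - y‖ ^ 2)) / d)
      ((-(c / (d * Real.sqrt (b + c * ‖x - y‖ ^ 2)))) • (x - y)) x := by
  rw [hasGradientAt_iff_hasFDerivAt]
  have h := ((((((((hasFDerivAt_id x).sub_const y).norm_sq).const_mul c).const_add b).sqrt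
    hR.ne').const_add a).mul_const d⁻¹).const_sub Φ
  simp only [← div_eq_mul_inv, id] at h
  refine h.congr_fderiv ?_
  ext v
  have hr := Real.sqrt_pos.mpr hR
  simp
  field_simp

theorem sign_mul_self_of_ne_zero {c : ℝ} (hc : c ≠ 0) :
    Real.sign c * Real.sign c = 1 := by
  rcases lt_or_gt_of_ne hc with h | h
  · simp [Real.sign_of_neg h]
  · simp [Real.sign_of_pos h]

theorem div_abs_self_eq_sign {c : ℝ} (hc : c ≠ 0) : c / |c| = Real.sign c := by
  rcases lt_or_gt_of_ne hc with h | h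
  · rw [Real.sign_of_neg h, abs_of_neg h, div_neg, div_self hc]
  · rw [Real.sign_of_pos h, abs_of_pos h, div_self hc]

/-- On the domain of the refraction generating function, `z` and the radicand are positive. -/
theorem refraction_domain_pos {κ z t : ℝ} (hκ0 : 0 < κ) (hκ1 : κ ≠ 1) (ht : 0 ≤ t)
    (h : (κ < 1 → Real.sqrt |κ ^ 2 - 1| * t < z) ∧ (1 < κ → 0 < z)) :
    0 < z ∧ 0 < z ^ 2 + (κ ^ 2 - 1) * t ^ 2 := by
  rcases lt_or_gt_of_ne hκ1 with h1 | h1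
  · have hz := h.1 h1
    have h0 : 0 ≤ Real.sqrt |κ ^ 2 - 1| * t := by positivity
    have hsq := pow_lt_pow_left₀ hz h0 two_ne_zero
    rw [mul_pow, Real.sq_sqrt (abs_nonneg _), abs_of_neg (by nlinarith)] at hsq
    exact ⟨h0.trans_lt hz, by linarith⟩
  · have hz := h.2 h1
    have : 0 < κ ^ 2 - 1 := by nlinarith
    exact ⟨hz, by positivity⟩


/-- Condition A1 for the flat-target refraction generating function
`g(x,y,z) = Φ − (κz + √(z² + (κ²−1)|x−y|²))/|κ²−1|` (domain `z > κ′|x−y|` for `0 < κ < 1`,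
`z > 0` for `κ > 1`): for `u < Φ` and `(κ²−1)|p|² < 1`, with `w = √(1+(1−κ²)|p|²)`,
`Z = |κ²−1|(Φ−u)w/(1+κw)` and `Y = x + sign(κ²−1)(Z/w)p`, the pair `(Y,Z)` is the unique
solution in the domain of `g(x,Y,Z) = u`, `∇ₓg(x,Y,Z) = p`. -/
theorem refraction_flat_A1 {n : ℕ}
    (κ : ℝ) (hκ0 : 0 < κ) (hκ1 : κ ≠ 1) (Φ : ℝ)
    (x : EuclideanSpace ℝ (Fin n)) (u : ℝ) (hu : u < Φ)
    (p : EuclideanSpace ℝ (Fin n)) (hp : (κ ^ 2 - 1) * ‖p‖ ^ 2 < 1)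
    (w Z : ℝ) (Y : EuclideanSpace ℝ (Fin n))
    (hw : w = Real.sqrt (1 + (1 - κ ^ 2) * ‖p‖ ^ 2))
    (hZ : Z = |κ ^ 2 - 1| * (Φ - u) * w / (1 + κ * w))
    (hY : Y = x + (Real.sign (κ ^ 2 - 1) * (Z / w)) • p) :
    ((κ < 1 → Real.sqrt |κ ^ 2 - 1| * ‖x - Y‖ < Z) ∧ (1 < κ → 0 < Z))
    ∧ Φ - (κ * Z + Real.sqrt (Z ^ 2 + (κ ^ 2 - 1) * ‖x - Y‖ ^ 2)) / |κ ^ 2 - 1| = u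
    ∧ gradient (fun x' =>
        Φ - (κ * Z + Real.sqrt (Z ^ 2 + (κ ^ 2 - 1) * ‖x' - Y‖ ^ 2)) / |κ ^ 2 - 1|) x = p
    ∧ ∀ (y : EuclideanSpace ℝ (Fin n)) (z : ℝ),
        ((κ < 1 → Real.sqrt |κ ^ 2 - 1| * ‖x - y‖ < z) ∧ (1 < κ → 0 < z)) →
        Φ - (κ * z + Real.sqrt (z ^ 2 + (κ ^ 2 - 1) * ‖x - y‖ ^ 2)) / |κ ^ 2 - 1| = u →
        gradient (fun x' =>
          Φ - (κ * z + Real.sqrt (z ^ 2 + (κ ^ 2 - 1) * ‖x' - y‖ ^ 2)) / |κ ^ 2 - 1|) x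
          = p →
        y = Y ∧ z = Z := by
  have hc : κ ^ 2 - 1 ≠ 0 := by
    intro h
    rcases lt_or_gt_of_ne hκ1 with h1 | h1 <;> nlinarith
  have habs : 0 < |κ ^ 2 - 1| := abs_pos.mpr hc
  have hgrad : ∀ (y : EuclideanSpace ℝ (Fin n)) (z : ℝ), 0 < z ^ 2 + (κ ^ 2 - 1) * ‖x - y‖ ^ 2 →
      gradient (fun x' =>
        Φ - (κ * z + Real.sqrt (z ^ 2 + (κ ^ 2 - 1) * ‖x' - y‖ ^ 2)) / |κ ^ 2 - 1|) x
      = (-(Real.sign (κ ^ 2 - 1) / Real.sqrt (z ^ 2 + (κ ^ 2 - 1) * ‖x - y‖ ^ 2))) • (x - y) := by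
    intro y z hR
    rw [(hasGradientAt_sub_sqrt_div Φ (κ * z) (z ^ 2) (κ ^ 2 - 1) |κ ^ 2 - 1| x y hR).gradient,
      ← div_abs_self_eq_sign hc, div_div]
  have hss := sign_mul_self_of_ne_zero hc
  set s := Real.sign (κ ^ 2 - 1)
  have hw2 : w ^ 2 = 1 - (κ ^ 2 - 1) * ‖p‖ ^ 2 := by
    rw [hw, Real.sq_sqrt (by linarith)]; ring
  have hw0 : 0 < w := by rw [hw]; exact Real.sqrt_pos.mpr (by linarith)
  have hkw : 0 < 1 + κ * w := by positivity
  have hnorm : ∀ r : ℝ, ‖(s * r) • p‖ ^ 2 = r ^ 2 * ‖p‖ ^ 2 := by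
    intro r
    rw [norm_smul, mul_pow, Real.norm_eq_abs, sq_abs]
    linear_combination r ^ 2 * ‖p‖ ^ 2 * hss
  have hΦ : 0 < Φ - u := sub_pos.mpr hu
  have hZ0 : 0 < Z := by rw [hZ]; positivity
  have hr0 : 0 < Z / w := by positivity
  have hxY : x - Y = -((s * (Z / w)) • p) := by rw [hY]; abel
  have hxY2 : ‖x - Y‖ ^ 2 = (Z / w) ^ 2 * ‖p‖ ^ 2 := by rw [hxY, norm_neg, hnorm]
  have hZw : Z = Z / w * w := by field_simp
  have hR : Z ^ 2 + (κ ^ 2 - 1) * ‖x - Y‖ ^ 2 = (Z / w) ^ 2 := by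
    rw [hxY2]
    linear_combination (Z + Z / w * w) * hZw + (Z / w) ^ 2 * hw2
  have hsqrt : Real.sqrt (Z ^ 2 + (κ ^ 2 - 1) * ‖x - Y‖ ^ 2) = Z / w := by
    rw [hR, Real.sqrt_sq hr0.le]
  refine ⟨⟨fun h1 => ?_, fun _ => hZ0⟩, ?_, ?_, ?_⟩
  · have hneg : κ ^ 2 - 1 < 0 := by nlinarith
    refine lt_of_pow_lt_pow_left₀ 2 hZ0.le ?_
    rw [mul_pow, Real.sq_sqrt (abs_nonneg _), abs_of_neg hneg]
    linarith [pow_pos hr0 2]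
  · rw [hsqrt, hZ]
    field_simp
    ring
  · rw [hgrad Y Z (by rw [hR]; positivity), hsqrt, hxY, smul_neg, neg_smul, neg_neg, smul_smul]
    have : s / (Z / w) * (s * (Z / w)) = 1 := by
      rw [← hss]; field_simp
    rw [this, one_smul]
  · intro y z hdom hval hgr
    obtain ⟨hz0, hRpos⟩ := refraction_domain_pos hκ0 hκ1 (norm_nonneg (x - y)) hdom
    rw [hgrad y z hRpos] at hgr
    have hrpos := Real.sqrt_pos.mpr hRpos
    have hrsq := Real.sq_sqrt hRpos.le
    set r := Real.sqrt (z ^ 2 + (κ ^ 2 - 1) * ‖x - y‖ ^ 2)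
    have hxy : x - y = -((s * r) • p) := by
      have : s * r * (s / r) = 1 := by
        rw [← hss]; field_simp
      rw [← hgr, smul_smul, mul_neg, this, neg_smul, one_smul, neg_neg]
    have hxy2 : ‖x - y‖ ^ 2 = r ^ 2 * ‖p‖ ^ 2 := by rw [hxy, norm_neg, hnorm]
    have hzr : z = r * w := by
      refine (pow_left_inj₀ hz0.le (by positivity) two_ne_zero).mp ?_
      rw [hxy2] at hrsq
      linear_combination -hrsq - r ^ 2 * hw2
    have hsum : κ * z + r = |κ ^ 2 - 1| * (Φ - u) := by
      rw [← hval]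
      field_simp
      ring
    have hrZ : r = Z / w := by
      rw [eq_div_iff hw0.ne', hZ, eq_div_iff hkw.ne', ← hsum, hzr]
      ring
    refine ⟨?_, by rw [hzr, hrZ, ← hZw]⟩
    have : x - y = x - Y := by rw [hxy, hxY, hrZ]
    exact sub_right_injective this
end
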